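/- Along any B₀ T²-symmetric Einstein flow, at every time τ one has | (1 − Π_τ/Π) Λ | ≲ |A| e^{−2τ} (1 + Π_τ/Π) + e^{−τ} (1 + e^{2(ΠE)^{1/2}}) (Π + Π_τ) E. -/

import Mathlib

noncomputable section

open Real MeasureTheory intervalIntegral

/-- The θ-mean of a function on the circle of circumference 1 (total measure 1). -/
def circleMean (f : ℝ → ℝ) : ℝ := ∫ θ in (0:ℝ)..1, f θ

/-- The smooth, θ-periodic fields `V, Q, ρ, l` of a T²-symmetric spacetime in areal
coordinates; first argument is `τ`, second is `θ`. -/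
structure T2Flow where
  V : ℝ → ℝ → ℝ
  Q : ℝ → ℝ → ℝ
  ρ : ℝ → ℝ → ℝ
  l : ℝ → ℝ → ℝ
  smooth_V : ContDiff ℝ (⊤ : ℕ∞) (Function.uncurry V)
  smooth_Q : ContDiff ℝ (⊤ : ℕ∞) (Function.uncurry Q)
  smooth_ρ : ContDiff ℝ (⊤ : ℕ∞) (Function.uncurry ρ)
  smooth_l : ContDiff ℝ (⊤ : ℕ∞) (Function.uncurry l)
  periodic_V : ∀ τ, Function.Periodic (V τ) 1
  periodic_Q : ∀ τ, Function.Periodic (Q τ) 1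
  periodic_ρ : ∀ τ, Function.Periodic (ρ τ) 1
  periodic_l : ∀ τ, Function.Periodic (l τ) 1

namespace T2Flow

/-- `V_τ`. -/
def Vτ (F : T2Flow) (τ θ : ℝ) : ℝ := deriv (fun s => F.V s θ) τ
/-- `V_θ`. -/
def Vθ (F : T2Flow) (τ θ : ℝ) : ℝ := deriv (fun x => F.V τ x) θ
/-- `Q_τ`. -/
def Qτ (F : T2Flow) (τ θ : ℝ) : ℝ := deriv (fun s => F.Q s θ) τ
/-- `Q_θ`. -/
def Qθ (F : T2Flow) (τ θ : ℝ) : ℝ := deriv (fun x => F.Q τ x) θ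
/-- `ρ_τ`. -/
def ρτ (F : T2Flow) (τ θ : ℝ) : ℝ := deriv (fun s => F.ρ s θ) τ
/-- `l_τ`. -/
def lτ (F : T2Flow) (τ θ : ℝ) : ℝ := deriv (fun s => F.l s θ) τ
/-- `l_θ`. -/
def lθ (F : T2Flow) (τ θ : ℝ) : ℝ := deriv (fun x => F.l τ x) θ

/-- The energy density
`J = (1/2)[V_τ² + e^{2(τ−ρ)}V_θ² + e^{2(V−τ)}(Q_τ² + e^{2(τ−ρ)}Q_θ²)]`. -/
def J (F : T2Flow) (τ θ : ℝ) : ℝ :=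
  (1/2) * (F.Vτ τ θ ^ 2 + exp (2*(τ - F.ρ τ θ)) * F.Vθ τ θ ^ 2
    + exp (2*(F.V τ θ - τ)) * (F.Qτ τ θ ^ 2 + exp (2*(τ - F.ρ τ θ)) * F.Qθ τ θ ^ 2))

/-- The T²-symmetric vacuum Einstein evolution equations together with the
momentum constraint. -/
def IsEinsteinFlow (F : T2Flow) : Prop :=
  (∀ τ θ : ℝ, deriv (fun s => exp (F.ρ s θ) * F.Vτ s θ) τ
      = deriv (fun x => exp (2*τ - F.ρ τ x) * F.Vθ τ x) θ
        + exp (2*(F.V τ θ - τ) + F.ρ τ θ)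
          * (F.Qτ τ θ ^ 2 - exp (2*(τ - F.ρ τ θ)) * F.Qθ τ θ ^ 2)) ∧
  (∀ τ θ : ℝ, deriv (fun s => exp (F.ρ s θ + 2*(F.V s θ - s)) * F.Qτ s θ) τ
      = deriv (fun x => exp (-F.ρ τ x + 2*F.V τ x) * F.Qθ τ x) θ) ∧
  (∀ τ θ : ℝ, F.lτ τ θ + F.ρτ τ θ + 2 = F.J τ θ) ∧
  (∀ τ θ : ℝ, F.ρτ τ θ = exp (F.l τ θ)) ∧
  (∀ τ θ : ℝ, F.lθ τ θ = F.Vθ τ θ * F.Vτ τ θ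
      + exp (2*(F.V τ θ - τ)) * F.Qθ τ θ * F.Qτ τ θ)

/-- The conserved quantity `A = ∫ e^ρ (V_τ − e^{2(V−τ)} Q_τ Q) dθ`. -/
def A (F : T2Flow) (τ : ℝ) : ℝ :=
  ∫ θ in (0:ℝ)..1,
    exp (F.ρ τ θ) * (F.Vτ τ θ - exp (2*(F.V τ θ - τ)) * F.Qτ τ θ * F.Q τ θ)

/-- The conserved quantity `B = ∫ e^{ρ+2(V−τ)} Q_τ dθ`. -/
def B (F : T2Flow) (τ : ℝ) : ℝ :=
  ∫ θ in (0:ℝ)..1, exp (F.ρ τ θ + 2*(F.V τ θ - τ)) * F.Qτ τ θ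

/-- The energy `E = ∫ e^{ρ−2τ} J dθ`. -/
def E (F : T2Flow) (τ : ℝ) : ℝ := ∫ θ in (0:ℝ)..1, exp (F.ρ τ θ - 2*τ) * F.J τ θ

/-- The `S¹`-volume `Π = ⟨e^ρ⟩`. -/
def Pi (F : T2Flow) (τ : ℝ) : ℝ := ∫ θ in (0:ℝ)..1, exp (F.ρ τ θ)

/-- The correction `Λ = (1/2) e^{−2τ} ∫ V_τ (V − ⟨V⟩ − 1) e^ρ dθ`. -/
def Λ (F : T2Flow) (τ : ℝ) : ℝ :=
  (1/2) * exp (-2*τ) *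
    ∫ θ in (0:ℝ)..1, F.Vτ τ θ * (F.V τ θ - circleMean (F.V τ) - 1) * exp (F.ρ τ θ)

/-- The corrected, normalized energy `H = Π (E + Λ)`. -/
def H (F : T2Flow) (τ : ℝ) : ℝ := F.Pi τ * (F.E τ + F.Λ τ)

/-- The twist potential `Y = ⟨e^{l+ρ+2τ}⟩`. -/
def Y (F : T2Flow) (τ : ℝ) : ℝ := ∫ θ in (0:ℝ)..1, exp (F.l τ θ + F.ρ τ θ + 2*τ)

/-- The error term `Ω = ⟨e^{l+ρ+2τ} J⟩ − e^{2τ} E Y Π⁻¹`. -/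
def Ω (F : T2Flow) (τ : ℝ) : ℝ :=
  (∫ θ in (0:ℝ)..1, exp (F.l τ θ + F.ρ τ θ + 2*τ) * F.J τ θ)
    - exp (2*τ) * F.E τ * F.Y τ / F.Pi τ

end T2Flow

/-- Cauchy–Schwarz on the unit interval for continuous functions. -/
lemma integral_mul_le_sqrt {f g : ℝ → ℝ} (hf : Continuous f) (hg : Continuous g) :
    ∫ x in (0:ℝ)..1, f x * g x
      ≤ √((∫ x in (0:ℝ)..1, f x ^ 2) * ∫ x in (0:ℝ)..1, g x ^ 2) := by
  have key : ∀ t : ℝ, 0 ≤ (∫ x in (0:ℝ)..1, f x ^ 2) * (t * t)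
      + (2 * ∫ x in (0:ℝ)..1, f x * g x) * t + ∫ x in (0:ℝ)..1, g x ^ 2 := by
    intro t
    have hexp : ∫ x in (0:ℝ)..1, (t * f x + g x) ^ 2
        = (∫ x in (0:ℝ)..1, f x ^ 2) * (t * t)
          + (2 * ∫ x in (0:ℝ)..1, f x * g x) * t + ∫ x in (0:ℝ)..1, g x ^ 2 := by
      have hpt : ∀ x, (t * f x + g x) ^ 2
          = (t * t) * f x ^ 2 + (2 * t) * (f x * g x) + g x ^ 2 := fun x => by ring
      simp_rw [hpt]
      rw [intervalIntegral.integral_add, intervalIntegral.integral_add,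
        intervalIntegral.integral_const_mul, intervalIntegral.integral_const_mul]
      · ring
      all_goals exact Continuous.intervalIntegrable (by fun_prop) _ _
    rw [← hexp]
    exact intervalIntegral.integral_nonneg zero_le_one fun x _ => sq_nonneg _
  have hd := discrim_le_zero key
  rw [discrim] at hd
  exact Real.le_sqrt_of_sq_le (by nlinarith)

/-- The oscillation of a `C¹` function on the unit interval is at most the `L¹` norm of its
derivative. -/
lemma abs_sub_le_integral_abs_deriv {f : ℝ → ℝ} (hf : ContDiff ℝ 1 f) {x y : ℝ}
    (hx : x ∈ Set.Icc (0:ℝ) 1) (hy : y ∈ Set.Icc (0:ℝ) 1) :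
    |f x - f y| ≤ ∫ z in (0:ℝ)..1, |deriv f z| := by
  have hc : Continuous (deriv f) := hf.continuous_deriv le_rfl
  rw [← intervalIntegral.integral_deriv_eq_sub
    (fun z _ => hf.differentiable one_ne_zero z) (hc.intervalIntegrable y x)]
  refine (intervalIntegral.norm_integral_le_integral_norm_uIoc (f := deriv f)).trans ?_
  rw [intervalIntegral.integral_of_le zero_le_one]
  refine setIntegral_mono_set (hc.abs.integrableOn_Icc.mono_set Set.Ioc_subset_Icc_self)
    (Filter.Eventually.of_forall fun z => abs_nonneg _)
    (LE.le.eventuallyLE ?_)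
  exact Set.Ioc_subset_Ioc (le_min hy.1 hx.1) (max_le hy.2 hx.2)

/-- Partial derivatives in the first variable of a smooth function are continuous in the
second. -/
lemma continuous_deriv_fst {f : ℝ → ℝ → ℝ} (hf : ContDiff ℝ (⊤ : ℕ∞) (Function.uncurry f))
    (τ : ℝ) : Continuous fun θ => deriv (fun s => f s θ) τ := by
  have h : (fun θ => deriv (fun s => f s θ) τ)
      = fun θ => fderiv ℝ (Function.uncurry f) (τ, θ) (1, 0) := by
    funext θ
    have h1 : HasFDerivAt (Function.uncurry f) (fderiv ℝ (Function.uncurry f) (τ, θ)) (τ, θ) :=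
      (hf.differentiable (by simp) (τ, θ)).hasFDerivAt
    have h2 : HasDerivAt (fun s : ℝ => (s, θ)) ((1 : ℝ), (0 : ℝ)) τ :=
      (hasDerivAt_id τ).prodMk (hasDerivAt_const τ θ)
    exact (h1.comp_hasDerivAt τ h2).deriv
  rw [h]
  have h3 : Continuous (fderiv ℝ (Function.uncurry f)) := hf.continuous_fderiv (by simp)
  fun_prop

/-- Slices in the second variable of a smooth function are `C¹`. -/
lemma contDiff_slice {f : ℝ → ℝ → ℝ} (hf : ContDiff ℝ (⊤ : ℕ∞) (Function.uncurry f))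
    (τ : ℝ) : ContDiff ℝ 1 (f τ) := by
  have h : ContDiff ℝ 1 (Function.uncurry f) := hf.of_le (by exact_mod_cast le_top)
  exact h.comp (contDiff_const.prodMk contDiff_id)

namespace T2Flow

variable (F : T2Flow) (τ : ℝ)

lemma contDiff_V : ContDiff ℝ 1 (F.V τ) := contDiff_slice F.smooth_V τ

lemma contDiff_Q : ContDiff ℝ 1 (F.Q τ) := contDiff_slice F.smooth_Q τ

@[fun_prop]
lemma continuous_V : Continuous (F.V τ) := (F.contDiff_V τ).continuous

@[fun_prop]
lemma continuous_Q : Continuous (F.Q τ) := (F.contDiff_Q τ).continuous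

@[fun_prop]
lemma continuous_ρ : Continuous (F.ρ τ) := (contDiff_slice F.smooth_ρ τ).continuous

@[fun_prop]
lemma continuous_Vτ : Continuous (F.Vτ τ) := continuous_deriv_fst F.smooth_V τ

@[fun_prop]
lemma continuous_Qτ : Continuous (F.Qτ τ) := continuous_deriv_fst F.smooth_Q τ

@[fun_prop]
lemma continuous_Vθ : Continuous (F.Vθ τ) := (F.contDiff_V τ).continuous_deriv le_rfl

@[fun_prop]
lemma continuous_Qθ : Continuous (F.Qθ τ) := (F.contDiff_Q τ).continuous_deriv le_rfl

@[fun_prop]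
lemma continuous_J : Continuous (F.J τ) := by
  unfold J
  fun_prop

lemma Pi_pos : 0 < F.Pi τ := by
  refine intervalIntegral.intervalIntegral_pos_of_pos
    (Continuous.intervalIntegrable (by fun_prop) _ _) (fun x => exp_pos _) zero_lt_one

lemma J_nonneg (θ : ℝ) : 0 ≤ F.J τ θ := by
  unfold J
  positivity

lemma E_nonneg : 0 ≤ F.E τ :=
  intervalIntegral.integral_nonneg zero_le_one
    fun θ _ => mul_nonneg (exp_pos _).le (F.J_nonneg τ θ)

variable {F}

/-- The volume of an expanding flow is nondecreasing. -/
lemma IsEinsteinFlow.deriv_Pi_nonneg (hF : F.IsEinsteinFlow) : 0 ≤ deriv F.Pi τ := by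
  have hmono : Monotone F.Pi := by
    intro s t hst
    refine intervalIntegral.integral_mono_on zero_le_one
      (Continuous.intervalIntegrable (by fun_prop) _ _)
      (Continuous.intervalIntegrable (by fun_prop) _ _) fun θ _ => exp_le_exp.2 ?_
    have hd : Differentiable ℝ fun r => F.ρ r θ := by
      have h := F.smooth_ρ.differentiable (by simp)
      exact h.comp (differentiable_id.prodMk (differentiable_const θ))
    refine monotone_of_deriv_nonneg hd (fun r => ?_) hst
    have h := hF.2.2.2.1 r θ
    rw [ρτ] at h
    rw [h]
    exact (exp_pos _).le
  exact hmono.deriv_nonneg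

variable (F)

/-- A function controlled by the energy density has `L¹` norm at most `(2ΠE)^{1/2}`. -/
lemma integral_abs_le {h : ℝ → ℝ} (hc : Continuous h)
    (hJ : ∀ θ, exp (-F.ρ τ θ) * h θ ^ 2 ≤ 2 * (exp (F.ρ τ θ - 2 * τ) * F.J τ θ)) :
    ∫ θ in (0:ℝ)..1, |h θ| ≤ √(2 * (F.Pi τ * F.E τ)) := by
  have hsq : ∀ θ, exp (F.ρ τ θ / 2) ^ 2 = exp (F.ρ τ θ) := fun θ => by
    rw [← exp_nat_mul]; congr 1; push_cast; ring
  have hsq' : ∀ θ, (exp (-F.ρ τ θ / 2) * |h θ|) ^ 2 = exp (-F.ρ τ θ) * h θ ^ 2 := fun θ => by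
    rw [mul_pow, sq_abs, ← exp_nat_mul]; congr 2; push_cast; ring
  have hprod : ∀ θ, |h θ| = exp (F.ρ τ θ / 2) * (exp (-F.ρ τ θ / 2) * |h θ|) := fun θ => by
    rw [← mul_assoc, ← exp_add]; ring_nf; simp
  have hcs := integral_mul_le_sqrt (f := fun θ => exp (F.ρ τ θ / 2))
    (g := fun θ => exp (-F.ρ τ θ / 2) * |h θ|) (by fun_prop) (by fun_prop)
  simp only [hsq, hsq', ← hprod] at hcs
  refine hcs.trans (Real.sqrt_le_sqrt ?_)
  have hE : ∫ θ in (0:ℝ)..1, exp (-F.ρ τ θ) * h θ ^ 2 ≤ 2 * F.E τ := by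
    rw [E, ← intervalIntegral.integral_const_mul]
    exact intervalIntegral.integral_mono_on zero_le_one
      (Continuous.intervalIntegrable (by fun_prop) _ _)
      (Continuous.intervalIntegrable (by fun_prop) _ _) fun θ _ => hJ θ
  calc _ ≤ F.Pi τ * (2 * F.E τ) := mul_le_mul_of_nonneg_left hE (F.Pi_pos τ).le
    _ = _ := by ring

/-- The energy density splits into the four quadratic contributions. -/
lemma two_mul_exp_mul_J (θ : ℝ) :
    2 * (exp (F.ρ τ θ - 2 * τ) * F.J τ θ)
      = exp (-F.ρ τ θ) * (exp (F.ρ τ θ - τ) * F.Vτ τ θ) ^ 2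
        + exp (-F.ρ τ θ) * F.Vθ τ θ ^ 2
        + exp (-F.ρ τ θ) * (exp (F.ρ τ θ + F.V τ θ - 2 * τ) * F.Qτ τ θ) ^ 2
        + exp (-F.ρ τ θ) * (exp (F.V τ θ - τ) * F.Qθ τ θ) ^ 2 := by
  simp only [J, mul_pow, ← exp_nat_mul, mul_add, ← mul_assoc]
  have e1 : exp (F.ρ τ θ - 2 * τ) * exp (2 * (τ - F.ρ τ θ)) = exp (-F.ρ τ θ) := by
    rw [← exp_add]; ring_nf
  have e2 : exp (-F.ρ τ θ) * exp ((2 : ℕ) * (F.ρ τ θ - τ)) = exp (F.ρ τ θ - 2 * τ) := by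
    rw [← exp_add]; push_cast; ring_nf
  have e3 : exp (-F.ρ τ θ) * exp ((2 : ℕ) * (F.ρ τ θ + F.V τ θ - 2 * τ))
      = exp (F.ρ τ θ - 2 * τ) * exp (2 * (F.V τ θ - τ)) := by
    rw [← exp_add, ← exp_add]; push_cast; ring_nf
  have e4 : exp (-F.ρ τ θ) * exp ((2 : ℕ) * (F.V τ θ - τ))
      = exp (F.ρ τ θ - 2 * τ) * exp (2 * (F.V τ θ - τ)) * exp (2 * (τ - F.ρ τ θ)) := by
    rw [← exp_add, ← exp_add, ← exp_add]; push_cast; ring_nf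
  push_cast at e2 e3 e4 ⊢
  linear_combination F.Vθ τ θ ^ 2 * e1 - F.Vτ τ θ ^ 2 * e2 - F.Qτ τ θ ^ 2 * e3
    - F.Qθ τ θ ^ 2 * e4

lemma integral_abs_Vτ_le :
    ∫ θ in (0:ℝ)..1, |exp (F.ρ τ θ - τ) * F.Vτ τ θ| ≤ √(2 * (F.Pi τ * F.E τ)) := by
  refine F.integral_abs_le τ (by fun_prop) fun θ => ?_
  rw [two_mul_exp_mul_J, add_assoc, add_assoc]
  exact le_add_of_nonneg_right (by positivity)

lemma integral_abs_Vθ_le : ∫ θ in (0:ℝ)..1, |F.Vθ τ θ| ≤ √(2 * (F.Pi τ * F.E τ)) := by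
  refine F.integral_abs_le τ (by fun_prop) fun θ => ?_
  rw [two_mul_exp_mul_J]
  exact le_add_of_le_of_nonneg (le_add_of_le_of_nonneg
    (le_add_of_nonneg_left (by positivity)) (by positivity)) (by positivity)

lemma integral_abs_Qτ_le :
    ∫ θ in (0:ℝ)..1, |exp (F.ρ τ θ + F.V τ θ - 2 * τ) * F.Qτ τ θ|
      ≤ √(2 * (F.Pi τ * F.E τ)) := by
  refine F.integral_abs_le τ (by fun_prop) fun θ => ?_
  rw [two_mul_exp_mul_J]
  exact le_add_of_le_of_nonneg (le_add_of_nonneg_left (by positivity)) (by positivity)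

lemma integral_abs_Qθ_le :
    ∫ θ in (0:ℝ)..1, |exp (F.V τ θ - τ) * F.Qθ τ θ| ≤ √(2 * (F.Pi τ * F.E τ)) := by
  refine F.integral_abs_le τ (by fun_prop) fun θ => ?_
  rw [two_mul_exp_mul_J]
  exact le_add_of_nonneg_left (by positivity)

lemma abs_V_sub_le {x y : ℝ} (hx : x ∈ Set.Icc (0:ℝ) 1) (hy : y ∈ Set.Icc (0:ℝ) 1) :
    |F.V τ x - F.V τ y| ≤ √(2 * (F.Pi τ * F.E τ)) :=
  (abs_sub_le_integral_abs_deriv (F.contDiff_V τ) hx hy).trans (F.integral_abs_Vθ_le τ)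

lemma abs_V_sub_circleMean_le {x : ℝ} (hx : x ∈ Set.Icc (0:ℝ) 1) :
    |F.V τ x - circleMean (F.V τ)| ≤ √(2 * (F.Pi τ * F.E τ)) := by
  have h : F.V τ x - circleMean (F.V τ) = ∫ y in (0:ℝ)..1, (F.V τ x - F.V τ y) := by
    rw [intervalIntegral.integral_sub (by simp)
      (Continuous.intervalIntegrable (by fun_prop) _ _)]
    simp [circleMean]
  rw [h]
  have := intervalIntegral.norm_integral_le_of_norm_le_const (a := (0:ℝ)) (b := 1)
    (f := fun y => F.V τ x - F.V τ y) (C := √(2 * (F.Pi τ * F.E τ))) fun y hy => by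
      rw [Set.uIoc_of_le zero_le_one] at hy
      exact F.abs_V_sub_le τ hx (Set.Ioc_subset_Icc_self hy)
  simpa using this

/-- The oscillation of `Q`, weighted by `e^V`, is controlled by the energy. -/
lemma exp_V_mul_abs_Q_sub_le {x : ℝ} (hx : x ∈ Set.Icc (0:ℝ) 1) :
    exp (F.V τ x) * |F.Q τ x - F.Q τ 0|
      ≤ exp (√(2 * (F.Pi τ * F.E τ)) + τ) * √(2 * (F.Pi τ * F.E τ)) := by
  have h0 : (0:ℝ) ∈ Set.Icc (0:ℝ) 1 := by simp
  calc exp (F.V τ x) * |F.Q τ x - F.Q τ 0|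
      ≤ exp (F.V τ x) * ∫ y in (0:ℝ)..1, |F.Qθ τ y| :=
        mul_le_mul_of_nonneg_left
          (abs_sub_le_integral_abs_deriv (F.contDiff_Q τ) hx h0) (exp_pos _).le
    _ = ∫ y in (0:ℝ)..1, exp (F.V τ x) * |F.Qθ τ y| := by
        rw [intervalIntegral.integral_const_mul]
    _ ≤ ∫ y in (0:ℝ)..1, exp (√(2 * (F.Pi τ * F.E τ)) + τ)
          * |exp (F.V τ y - τ) * F.Qθ τ y| := by
        refine intervalIntegral.integral_mono_on zero_le_one
          (Continuous.intervalIntegrable (by fun_prop) _ _)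
          (Continuous.intervalIntegrable (by fun_prop) _ _) fun y hy => ?_
        rw [abs_mul, abs_exp, ← mul_assoc, ← exp_add]
        refine mul_le_mul_of_nonneg_right (exp_le_exp.2 ?_) (abs_nonneg _)
        linarith [(abs_le.1 (F.abs_V_sub_le τ hx hy)).2]
    _ ≤ _ := by
        rw [intervalIntegral.integral_const_mul]
        exact mul_le_mul_of_nonneg_left (F.integral_abs_Qθ_le τ) (exp_pos _).le

/-- The momentum `∫ V_τ e^ρ` differs from `A` by an energy term when `B = 0`. -/
lemma abs_integral_exp_mul_Vτ_le (hB : F.B τ = 0) :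
    |∫ θ in (0:ℝ)..1, exp (F.ρ τ θ) * F.Vτ τ θ|
      ≤ |F.A τ| + 2 * exp (√(2 * (F.Pi τ * F.E τ)) + τ) * (F.Pi τ * F.E τ) := by
  set M := √(2 * (F.Pi τ * F.E τ))
  have hMsq : M * M = 2 * (F.Pi τ * F.E τ) := Real.mul_self_sqrt
    (mul_nonneg zero_le_two (mul_nonneg (F.Pi_pos τ).le (F.E_nonneg τ)))
  have hsplit : ∫ θ in (0:ℝ)..1, exp (F.ρ τ θ) * F.Vτ τ θ
      = F.A τ + (∫ θ in (0:ℝ)..1,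
          exp (F.ρ τ θ + 2 * (F.V τ θ - τ)) * F.Qτ τ θ * (F.Q τ θ - F.Q τ 0))
        + F.Q τ 0 * F.B τ := by
    rw [A, B, ← intervalIntegral.integral_const_mul, ← intervalIntegral.integral_add,
      ← intervalIntegral.integral_add]
    · refine intervalIntegral.integral_congr fun θ _ => ?_
      simp only [exp_add]
      ring
    all_goals exact Continuous.intervalIntegrable (by fun_prop) _ _
  rw [hsplit, hB, mul_zero, add_zero]
  refine (abs_add_le _ _).trans (add_le_add le_rfl ?_)
  calc |∫ θ in (0:ℝ)..1, exp (F.ρ τ θ + 2 * (F.V τ θ - τ)) * F.Qτ τ θ * (F.Q τ θ - F.Q τ 0)|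
      ≤ ∫ θ in (0:ℝ)..1,
          |exp (F.ρ τ θ + 2 * (F.V τ θ - τ)) * F.Qτ τ θ * (F.Q τ θ - F.Q τ 0)| :=
        intervalIntegral.abs_integral_le_integral_abs zero_le_one
    _ ≤ ∫ θ in (0:ℝ)..1, |exp (F.ρ τ θ + F.V τ θ - 2 * τ) * F.Qτ τ θ| * (exp (M + τ) * M) := by
        refine intervalIntegral.integral_mono_on zero_le_one
          (Continuous.intervalIntegrable (by fun_prop) _ _)
          (Continuous.intervalIntegrable (by fun_prop) _ _) fun θ hθ => ?_
        have he : exp (F.ρ τ θ + 2 * (F.V τ θ - τ))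
            = exp (F.ρ τ θ + F.V τ θ - 2 * τ) * exp (F.V τ θ) := by
          rw [← exp_add]; ring_nf
        calc _ = |exp (F.ρ τ θ + F.V τ θ - 2 * τ) * F.Qτ τ θ|
              * (exp (F.V τ θ) * |F.Q τ θ - F.Q τ 0|) := by
              rw [he]; simp only [abs_mul, abs_exp]; ring
          _ ≤ _ := mul_le_mul_of_nonneg_left (F.exp_V_mul_abs_Q_sub_le τ hθ) (abs_nonneg _)
    _ ≤ M * (exp (M + τ) * M) := by
        rw [intervalIntegral.integral_mul_const]
        exact mul_le_mul_of_nonneg_right (F.integral_abs_Qτ_le τ) (by positivity)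
    _ = 2 * exp (M + τ) * (F.Pi τ * F.E τ) := by linear_combination exp (M + τ) * hMsq

lemma abs_integral_Vτ_mul_sub_circleMean_le :
    |∫ θ in (0:ℝ)..1, F.Vτ τ θ * (F.V τ θ - circleMean (F.V τ)) * exp (F.ρ τ θ)|
      ≤ 2 * exp τ * (F.Pi τ * F.E τ) := by
  set M := √(2 * (F.Pi τ * F.E τ))
  have hMsq : M * M = 2 * (F.Pi τ * F.E τ) := Real.mul_self_sqrt
    (mul_nonneg zero_le_two (mul_nonneg (F.Pi_pos τ).le (F.E_nonneg τ)))
  calc _ ≤ ∫ θ in (0:ℝ)..1,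
          |F.Vτ τ θ * (F.V τ θ - circleMean (F.V τ)) * exp (F.ρ τ θ)| :=
        intervalIntegral.abs_integral_le_integral_abs zero_le_one
    _ ≤ ∫ θ in (0:ℝ)..1, |exp (F.ρ τ θ - τ) * F.Vτ τ θ| * (exp τ * M) := by
        refine intervalIntegral.integral_mono_on zero_le_one
          (Continuous.intervalIntegrable (by fun_prop) _ _)
          (Continuous.intervalIntegrable (by fun_prop) _ _) fun θ hθ => ?_
        have he : exp (F.ρ τ θ) = exp (F.ρ τ θ - τ) * exp τ := by rw [← exp_add]; ring_nf
        calc _ = |exp (F.ρ τ θ - τ) * F.Vτ τ θ|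
              * (exp τ * |F.V τ θ - circleMean (F.V τ)|) := by
              rw [he]; simp only [abs_mul, abs_exp]; ring
          _ ≤ _ := by gcongr; exact F.abs_V_sub_circleMean_le τ hθ
    _ ≤ M * (exp τ * M) := by
        rw [intervalIntegral.integral_mul_const]
        exact mul_le_mul_of_nonneg_right (F.integral_abs_Vτ_le τ) (by positivity)
    _ = 2 * exp τ * (F.Pi τ * F.E τ) := by linear_combination exp τ * hMsq

/-- Pointwise-in-time bound on the correction `Λ`. -/
lemma abs_Λ_le (hB : F.B τ = 0) :
    |F.Λ τ| ≤ |F.A τ| * exp (-2 * τ)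
      + exp (-τ) * (1 + exp (2 * √(F.Pi τ * F.E τ))) * (F.Pi τ * F.E τ) := by
  have hPE : 0 ≤ F.Pi τ * F.E τ := mul_nonneg (F.Pi_pos τ).le (F.E_nonneg τ)
  have hΛ : F.Λ τ = 1 / 2 * exp (-2 * τ)
      * ((∫ θ in (0:ℝ)..1, F.Vτ τ θ * (F.V τ θ - circleMean (F.V τ)) * exp (F.ρ τ θ))
        - ∫ θ in (0:ℝ)..1, exp (F.ρ τ θ) * F.Vτ τ θ) := by
    rw [Λ, ← intervalIntegral.integral_sub]
    · congr 1
      refine intervalIntegral.integral_congr fun θ _ => ?_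
      ring
    all_goals exact Continuous.intervalIntegrable (by fun_prop) _ _
  have hM : √(2 * (F.Pi τ * F.E τ)) ≤ 2 * √(F.Pi τ * F.E τ) := by
    rw [Real.sqrt_mul zero_le_two]
    refine mul_le_mul_of_nonneg_right ?_ (Real.sqrt_nonneg _)
    rw [Real.sqrt_le_left zero_le_two]
    norm_num
  have hexp : exp (√(2 * (F.Pi τ * F.E τ)) + τ) ≤ exp τ * exp (2 * √(F.Pi τ * F.E τ)) := by
    rw [← exp_add]
    exact exp_le_exp.2 (by linarith)
  have he : exp (-2 * τ) * exp τ = exp (-τ) := by rw [← exp_add]; ring_nf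
  have h1 := F.abs_integral_Vτ_mul_sub_circleMean_le τ
  have h2 := F.abs_integral_exp_mul_Vτ_le τ hB
  rw [hΛ, abs_mul, abs_of_nonneg (by positivity)]
  calc _ ≤ 1 / 2 * exp (-2 * τ) * (2 * exp τ * (F.Pi τ * F.E τ) + (|F.A τ|
          + 2 * (exp τ * exp (2 * √(F.Pi τ * F.E τ))) * (F.Pi τ * F.E τ))) := by
        refine mul_le_mul_of_nonneg_left ?_ (by positivity)
        refine (abs_sub _ _).trans (add_le_add h1 (h2.trans ?_))
        gcongr
    _ = 1 / 2 * (|F.A τ| * exp (-2 * τ))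
        + exp (-τ) * (1 + exp (2 * √(F.Pi τ * F.E τ))) * (F.Pi τ * F.E τ) := by
        rw [← he]; ring
    _ ≤ _ := by
        have : 0 ≤ |F.A τ| * exp (-2 * τ) := by positivity
        linarith

end T2Flow

/-- For `B₀` solutions,
`|(1 − Π_τ/Π)Λ| ≲ |A| e^{−2τ} (1 + Π_τ/Π) + e^{−τ}(1 + e^{2(ΠE)^{1/2}})(Π + Π_τ)E`. -/
theorem lambda_error_bound :
    ∃ C : ℝ, 0 < C ∧ ∀ (F : T2Flow), F.IsEinsteinFlow → (∀ τ : ℝ, F.B τ = 0) →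
      ∀ τ : ℝ,
        |(1 - deriv F.Pi τ / F.Pi τ) * F.Λ τ|
          ≤ C * (|F.A τ| * Real.exp (-2*τ) * (1 + deriv F.Pi τ / F.Pi τ)
              + Real.exp (-τ) * (1 + Real.exp (2 * Real.sqrt (F.Pi τ * F.E τ)))
                * (F.Pi τ + deriv F.Pi τ) * F.E τ) := by
  refine ⟨1, one_pos, fun F hF hB τ => ?_⟩
  have hP := F.Pi_pos τ
  have hr : 0 ≤ deriv F.Pi τ / F.Pi τ := div_nonneg (hF.deriv_Pi_nonneg τ) hP.le
  have h1 : |1 - deriv F.Pi τ / F.Pi τ| ≤ 1 + deriv F.Pi τ / F.Pi τ :=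
    abs_le.2 ⟨by linarith, by linarith⟩
  rw [abs_mul]
  refine (mul_le_mul h1 (F.abs_Λ_le τ (hB τ)) (abs_nonneg _) (by linarith)).trans
    (le_of_eq ?_)
  field_simp
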